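/- Let n = 3r and let (C, C̄) be an equitable partition of Q_n with quotient matrix [[0,3r],[r,2r]] such that ⟨c, v⟩ = 0 for every c ∈ C, where v = 1^{2r}0^r (ones in the first 2r coordinates). Define D = {x ∈ F_2^{2r} : (x, 0^r) ∈ C}, D'' = the set of odd-weight words of F_2^{2r}, and D' = {even-weight words of F_2^{2r}} \ D. Then (D, D', D'') is an equitable partition of Q_{2r} with quotient matrix [[0,0,2r],[0,0,2r],[r,r,0]]. -/

import Mathlib

/-- Binary words of length `n`: the vertex set of the hypercube `Q_n`. -/
abbrev BW (n : ℕ) := Fin n → ZMod 2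

/-- Adjacency in a Hamming-type graph (hypercube `Q_n`, Hamming graph `H(r,q)`, ...):
two words are adjacent iff they differ in exactly one coordinate. -/
def hAdj {ι : Type*} {β : ι → Type*} [Fintype ι] [∀ i, DecidableEq (β i)]
    (x y : ∀ i, β i) : Prop :=
  hammingDist x y = 1

/-- `(Cs i)_{i < k}` is an equitable partition of the graph with vertex set `V` and
adjacency relation `adj`, with quotient matrix `S`: the cells are nonempty, every vertex
lies in exactly one cell, and every vertex of `Cs i` has exactly `S i j` neighbors in `Cs j`. -/
def IsEquitablePartition {V : Type*} (adj : V → V → Prop) {k : ℕ}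
    (Cs : Fin k → Set V) (S : Fin k → Fin k → ℕ) : Prop :=
  (∀ i, (Cs i).Nonempty) ∧
  (∀ v : V, ∃! i, v ∈ Cs i) ∧
  ∀ i j : Fin k, ∀ v ∈ Cs i, {w | w ∈ Cs j ∧ adj v w}.ncard = S i j

theorem hAdj_iff_flip {n : ℕ} (x y : BW n) :
    hAdj x y ↔ ∃ i, y = x + Pi.single i 1 := by
  have key : ∀ a b : ZMod 2, a ≠ b → b = a + 1 := by decide
  unfold hAdj hammingDist
  rw [Finset.card_eq_one]
  constructor
  · rintro ⟨i, hi⟩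
    refine ⟨i, ?_⟩
    funext j
    have hj := Finset.ext_iff.mp hi j
    simp only [Finset.mem_filter, Finset.mem_univ, true_and, Finset.mem_singleton] at hj
    by_cases h : j = i
    · subst h
      simpa using key _ _ (hj.mpr rfl)
    · have : x j = y j := by
        by_contra h'
        exact h (hj.mp h')
      simp [h, this]
  · rintro ⟨i, rfl⟩
    refine ⟨i, ?_⟩
    ext j
    by_cases h : j = i
    · subst h
      simp
    · simp [h]

theorem ncard_nbrs {n : ℕ} (S : Set (BW n)) (x : BW n) :
    {w | w ∈ S ∧ hAdj x w}.ncard = {i : Fin n | x + Pi.single i 1 ∈ S}.ncard := by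
  have h : {w | w ∈ S ∧ hAdj x w}
      = (fun i : Fin n => x + Pi.single i (1 : ZMod 2)) '' {i | x + Pi.single i 1 ∈ S} := by
    ext w
    simp only [Set.mem_setOf_eq, Set.mem_image, hAdj_iff_flip]
    constructor
    · rintro ⟨hw, i, rfl⟩
      exact ⟨i, hw, rfl⟩
    · rintro ⟨i, hi, rfl⟩
      exact ⟨hi, i, rfl⟩
  rw [h]
  apply Set.ncard_image_of_injective
  intro i j hij
  have h1 : (Pi.single i (1 : ZMod 2) : BW n) = Pi.single j 1 := add_left_cancel hij
  by_contra hne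
  have := congrFun h1 i
  simp [hne] at this

theorem norm_cast_eq_sum {n : ℕ} (x : BW n) : ((hammingNorm x : ℕ) : ZMod 2) = ∑ i, x i := by
  have key : ∀ a : ZMod 2, (if a ≠ 0 then (1 : ZMod 2) else 0) = a := by decide
  unfold hammingNorm
  rw [Finset.card_filter]
  push_cast
  exact Finset.sum_congr rfl fun i _ => key (x i)

theorem even_norm_iff {n : ℕ} (x : BW n) : Even (hammingNorm x) ↔ ∑ i, x i = 0 := by
  rw [← norm_cast_eq_sum, ZMod.natCast_eq_zero_iff_even]

theorem even_flip {n : ℕ} (x : BW n) (i : Fin n) :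
    Even (hammingNorm (x + Pi.single i 1)) ↔ ¬ Even (hammingNorm x) := by
  have key : ∀ a : ZMod 2, a + 1 = 0 ↔ ¬ a = 0 := by decide
  rw [even_norm_iff, even_norm_iff, ← key]
  simp [Finset.sum_add_distrib]

theorem stmt_8 (r : ℕ) (C : Set (BW (2*r + r)))
    (hC : IsEquitablePartition hAdj ![C, Cᶜ] ![![0, 3*r], ![r, 2*r]])
    (hv : ∀ c ∈ C, ∑ i, c i * (Fin.append (fun _ => (1 : ZMod 2)) (0 : BW r)) i = 0)
    (D D' D'' : Set (BW (2*r)))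
    (hD : D = {x | Fin.append x (0 : BW r) ∈ C})
    (hD'' : D'' = {x | Odd (hammingNorm x)})
    (hD' : D' = {x | Even (hammingNorm x)} \ D) :
    IsEquitablePartition hAdj ![D, D', D'']
      ![![0, 0, 2*r], ![0, 0, 2*r], ![r, r, 0]] := by
  obtain ⟨hne, -, hcnt⟩ := hC
  have hr : 0 < r := by
    rcases Nat.eq_zero_or_pos r with h | h
    · subst h
      obtain ⟨a, ha⟩ := hne 0
      obtain ⟨b, hb⟩ := hne 1
      have : a = b := by
        funext i
        exact absurd i.isLt (by omega)
      subst this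
      simp at ha hb
      exact absurd ha hb
    · exact h
  -- words of `C` have even first part
  have hCeven : ∀ (x : BW (2*r)) (y : BW r), Fin.append x y ∈ C → Even (hammingNorm x) := by
    intro x y h
    have := hv _ h
    rw [Fin.sum_univ_add] at this
    rw [even_norm_iff]
    simpa using this
  have hDeven : ∀ x ∈ D, Even (hammingNorm x) := by
    intro x hx
    rw [hD] at hx
    exact hCeven x 0 hx
  have happL : ∀ (x : BW (2*r)) (i : Fin (2*r)),
      Fin.append x (0 : BW r) + Pi.single (Fin.castAdd r i) 1
        = Fin.append (x + Pi.single i 1) (0 : BW r) := by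
    intro x i
    funext k
    refine Fin.addCases (fun k => ?_) (fun k => ?_) k
    · by_cases h : k = i
      · subst h
        simp
      · simp [Pi.single_apply, h]
    · have : Fin.natAdd (2*r) k ≠ Fin.castAdd r i := by
        intro h
        have := congrArg Fin.val h
        simp at this
        omega
      simp [Pi.single_apply, this]
  have happR : ∀ (x : BW (2*r)) (j : Fin r),
      Fin.append x (0 : BW r) + Pi.single (Fin.natAdd (2*r) j) 1
        = Fin.append x (Pi.single j 1 : BW r) := by
    intro x j
    funext k
    refine Fin.addCases (fun k => ?_) (fun k => ?_) k
    · have : Fin.castAdd r k ≠ Fin.natAdd (2*r) j := by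
        intro h
        have := congrArg Fin.val h
        simp at this
        omega
      simp [Pi.single_apply, this]
    · by_cases h : k = j
      · subst h
        simp
      · simp [Pi.single_apply, h]
  have hcD : ∀ x : BW (2*r), ¬ Even (hammingNorm x) →
      {i : Fin (2*r) | x + Pi.single i 1 ∈ D}.ncard = r := by
    intro x hx
    have h1 := hcnt 1 0 (Fin.append x 0) (by
      change Fin.append x (0 : BW r) ∈ Cᶜ
      exact fun h => hx (hCeven x 0 h))
    rw [ncard_nbrs] at h1
    change {i | Fin.append x (0 : BW r) + Pi.single i 1 ∈ C}.ncard = r at h1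
    refine Eq.trans ?_ h1
    rw [← Set.ncard_image_of_injective _ (Fin.castAdd_injective (2*r) r)]
    congr 1
    ext k
    simp only [Set.mem_image, Set.mem_setOf_eq]
    constructor
    · rintro ⟨i, hi, rfl⟩
      rw [happL]
      rw [hD] at hi
      exact hi
    · refine Fin.addCases (fun i hi => ?_) (fun j hj => ?_) k
      · rw [happL] at hi
        exact ⟨i, by rw [hD]; exact hi, rfl⟩
      · rw [happR] at hj
        exact absurd (hCeven _ _ hj) hx
  have hcD' : ∀ x : BW (2*r), ¬ Even (hammingNorm x) →
      {i : Fin (2*r) | x + Pi.single i 1 ∈ D'}.ncard = r := by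
    intro x hx
    have h2 : {i : Fin (2*r) | x + Pi.single i 1 ∈ D'}
        = {i : Fin (2*r) | x + Pi.single i 1 ∈ D}ᶜ := by
      ext i
      simp [hD', even_flip, hx]
    have h3 := Set.ncard_add_ncard_compl {i : Fin (2*r) | x + Pi.single i 1 ∈ D}
    rw [← h2, hcD x hx, Nat.card_eq_fintype_card, Fintype.card_fin] at h3
    omega
  have hmem'' : ∀ x, x ∈ D'' ↔ ¬ Even (hammingNorm x) := by
    intro x
    rw [hD'']
    simp
  have hmem' : ∀ x, x ∈ D' ↔ Even (hammingNorm x) ∧ x ∉ D := by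
    intro x
    rw [hD']
    rfl
  have hE : ∀ x : BW (2*r), Even (hammingNorm x) → 
      {i : Fin (2*r) | x + Pi.single i 1 ∈ D}.ncard = 0 ∧
      {i : Fin (2*r) | x + Pi.single i 1 ∈ D'}.ncard = 0 ∧
      {i : Fin (2*r) | x + Pi.single i 1 ∈ D''}.ncard = 2*r := by
    intro x hx
    refine ⟨?_, ?_, ?_⟩
    · convert Set.ncard_empty (Fin (2*r))
      ext i
      simp only [Set.mem_setOf_eq, Set.mem_empty_iff_false, iff_false]
      intro h
      exact (even_flip x i).mp (hDeven _ h) hx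
    · convert Set.ncard_empty (Fin (2*r))
      ext i
      simp [hmem', even_flip, hx]
    · have : {i : Fin (2*r) | x + Pi.single i 1 ∈ D''} = Set.univ := by
        ext i
        simp only [Set.mem_setOf_eq, hmem'', even_flip, Set.mem_univ, iff_true]
        simpa using hx
      rw [this, Set.ncard_univ, Nat.card_eq_fintype_card, Fintype.card_fin]
  have hO : ∀ x : BW (2*r), ¬ Even (hammingNorm x) → 
      {i : Fin (2*r) | x + Pi.single i 1 ∈ D''}.ncard = 0 := by
    intro x hx
    convert Set.ncard_empty (Fin (2*r))
    ext i
    simp only [Set.mem_setOf_eq, hmem'', even_flip, Set.mem_empty_iff_false, iff_false]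
    simpa using hx
  obtain ⟨x0, hx0⟩ : ∃ x0 : BW (2*r), ¬ Even (hammingNorm x0) := by
    refine ⟨0 + Pi.single ⟨0, by omega⟩ 1, ?_⟩
    rw [even_flip]
    simp
  refine ⟨?_, ?_, ?_⟩
  · intro i
    fin_cases i
    · obtain ⟨i, hi⟩ := Set.nonempty_of_ncard_ne_zero (by rw [hcD x0 hx0]; omega)
      exact ⟨_, hi⟩
    · obtain ⟨i, hi⟩ := Set.nonempty_of_ncard_ne_zero (by rw [hcD' x0 hx0]; omega)
      exact ⟨_, hi⟩
    · exact ⟨x0, (hmem'' x0).mpr hx0⟩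
  · intro x
    by_cases hx : Even (hammingNorm x)
    · by_cases hxD : x ∈ D
      · refine ⟨0, hxD, ?_⟩
        intro j hj
        fin_cases j
        · rfl
        · exact absurd hxD ((hmem' x).mp hj).2
        · exact absurd hx ((hmem'' x).mp hj)
      · refine ⟨1, (hmem' x).mpr ⟨hx, hxD⟩, ?_⟩
        intro j hj
        fin_cases j
        · exact absurd hj hxD
        · rfl
        · exact absurd hx ((hmem'' x).mp hj)
    · refine ⟨2, (hmem'' x).mpr hx, ?_⟩
      intro j hj
      fin_cases j
      · exact absurd (hDeven x hj) hx
      · exact absurd ((hmem' x).mp hj).1 hx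
      · rfl
  · intro i j x hx
    rw [ncard_nbrs]
    fin_cases i
    · have h := hE x (hDeven x hx)
      fin_cases j
      exacts [h.1, h.2.1, h.2.2]
    · have h := hE x ((hmem' x).mp hx).1
      fin_cases j
      exacts [h.1, h.2.1, h.2.2]
    · have h := (hmem'' x).mp hx
      fin_cases j
      exacts [hcD x h, hcD' x h, hO x h]
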